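/- arXiv:1606.06310 — 6 statements merged into one kernel-verified Lean document; each statement's English description precedes it below -/
import Mathlib

section
/- Let A be a real m×n matrix, B a real p×n matrix with Range(x ↦ Bᵀx) = Ker(x ↦ Ax), and Q a real symmetric positive definite n×n matrix. Then ℝⁿ is the direct sum of Ker(x ↦ Bx) and Ker(x ↦ AQx): these two subspaces intersect only in {0} and their sum is all of ℝⁿ. -/
open Matrix

/-- If `Range(Bᵀ) = Ker(A)` and `Q` is symmetric positive definite, then `ℝⁿ` is the
direct sum of `Ker(B)` and `Ker(A Q)`. -/
theorem stmt_5 (m n p : ℕ) (A : Matrix (Fin m) (Fin n) ℝ) (B : Matrix (Fin p) (Fin n) ℝ)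
    (Q : Matrix (Fin n) (Fin n) ℝ)
    (hcompat : LinearMap.range (Bᵀ.mulVecLin) = LinearMap.ker (A.mulVecLin))
    (hQ : Q.PosDef) :
    LinearMap.ker (B.mulVecLin) ⊓ LinearMap.ker ((A * Q).mulVecLin) = ⊥ ∧
      LinearMap.ker (B.mulVecLin) ⊔ LinearMap.ker ((A * Q).mulVecLin) = ⊤ := by
  have hdisj : Disjoint (LinearMap.ker B.mulVecLin) (LinearMap.ker (A * Q).mulVecLin) := by
    rw [Submodule.disjoint_def]
    intro x hBx hAQx
    have hQx : Q *ᵥ x ∈ LinearMap.range Bᵀ.mulVecLin := by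
      rw [hcompat]
      simpa [mulVec_mulVec] using hAQx
    obtain ⟨y, hy⟩ := hQx
    by_contra hx
    have hpos := hQ.dotProduct_mulVec_pos hx
    rw [← hy, mulVecLin_apply, dotProduct_mulVec, vecMul_transpose, star_trivial,
      show B *ᵥ x = 0 from hBx, zero_dotProduct] at hpos
    exact hpos.false
  have hrank : (A * Q).rank = A.rank :=
    rank_mul_eq_left_of_isUnit_det Q A ((isUnit_iff_isUnit_det Q).mp hQ.isUnit)
  have hker : B.rank = Module.finrank ℝ (LinearMap.ker A.mulVecLin) := by
    rw [← hcompat, ← rank_transpose]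
    rfl
  have hA := A.mulVecLin.finrank_range_add_finrank_ker
  have hB := B.mulVecLin.finrank_range_add_finrank_ker
  have hAQ := (A * Q).mulVecLin.finrank_range_add_finrank_ker
  unfold rank at hrank hker
  have hcompl := (Submodule.isCompl_iff_disjoint _ _ (by lia)).mpr hdisj
  exact ⟨hcompl.inf_eq_bot, hcompl.sup_eq_top⟩
end

section
/- Let A be a real m×n matrix of full row rank (a ↦ Aᵀa injective), B a real p×n matrix with Range(x ↦ Bᵀx) = Ker(x ↦ Ax), and Q a real symmetric positive definite n×n matrix. For any u, λ ∈ ℝⁿ set μ := λ + Q u. Then Aᵀ (A Q Aᵀ)⁻¹ A μ = u holds if and only if both A λ = 0 and B u = 0 hold. -/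
open Matrix

theorem isUnit_det_mul_mul_transpose {m n : Type*} [Fintype m] [DecidableEq m] [Fintype n]
    {A : Matrix m n ℝ} {Q : Matrix n n ℝ}
    (hA : Function.Injective fun a : m → ℝ => Aᵀ *ᵥ a) (hQ : Q.PosDef) :
    IsUnit (A * Q * Aᵀ).det := by
  have h : Function.Injective A.vecMul := by
    simpa only [mulVec_transpose] using hA
  have hS := hQ.mul_mul_conjTranspose_same h
  rw [conjTranspose_eq_transpose_of_trivial] at hS
  exact (isUnit_iff_isUnit_det _).mp hS.isUnit

theorem mul_transpose_eq_zero_of_range_le_ker {m n p : Type*} [Fintype m] [Fintype n] [Fintype p]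
    {A : Matrix m n ℝ} {B : Matrix p n ℝ}
    (h : LinearMap.range Bᵀ.mulVecLin ≤ LinearMap.ker A.mulVecLin) : B * Aᵀ = 0 := by
  classical
  have hAB : A * Bᵀ = 0 := by
    refine ext_of_mulVec_single fun i => ?_
    have hi := h (LinearMap.mem_range_self Bᵀ.mulVecLin (Pi.single i 1))
    rw [LinearMap.mem_ker, mulVecLin_apply, mulVecLin_apply, mulVec_mulVec] at hi
    rw [hi, zero_mulVec]
  simpa using congrArg transpose hAB

theorem exists_transpose_mulVec_eq_of_mulVec_eq_zero {m n p : Type*} [Fintype m] [Fintype n]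
    [Fintype p] {A : Matrix m n ℝ} {B : Matrix p n ℝ}
    (hA : Function.Injective fun a : m → ℝ => Aᵀ *ᵥ a)
    (h : LinearMap.range Bᵀ.mulVecLin = LinearMap.ker A.mulVecLin)
    {u : n → ℝ} (hu : B *ᵥ u = 0) : ∃ a, Aᵀ *ᵥ a = u := by
  classical
  have hdet := isUnit_det_mul_mul_transpose hA PosDef.one
  rw [Matrix.mul_one] at hdet
  have hBA := mul_transpose_eq_zero_of_range_le_ker h.le
  refine ⟨(A * Aᵀ)⁻¹ *ᵥ (A *ᵥ u), ?_⟩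
  have hker : u - Aᵀ *ᵥ ((A * Aᵀ)⁻¹ *ᵥ (A *ᵥ u)) ∈ LinearMap.ker A.mulVecLin := by
    rw [LinearMap.mem_ker, mulVecLin_apply, mulVec_sub, mulVec_mulVec, mulVec_mulVec,
      mul_nonsing_inv _ hdet, one_mulVec, sub_self]
  rw [← h] at hker
  obtain ⟨c, hc⟩ := hker
  rw [mulVecLin_apply] at hc
  have hc0 : Bᵀ *ᵥ c = 0 := by
    have hBc : B *ᵥ (Bᵀ *ᵥ c) = 0 := by
      rw [hc, mulVec_sub, hu, mulVec_mulVec, hBA, zero_mulVec, sub_zero]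
    rw [← dotProduct_self_eq_zero]
    nth_rewrite 1 [mulVec_transpose]
    rw [← dotProduct_mulVec, hBc, dotProduct_zero]
  rw [hc0] at hc
  exact (sub_eq_zero.mp hc.symm).symm

/-- With `A` full row rank, `Range(Bᵀ) = Ker(A)` and `Q` symmetric positive definite,
setting `μ := λ + Q u`, the single mixed interface equation
`Aᵀ (A Q Aᵀ)⁻¹ A μ = u` holds iff `A λ = 0` and `B u = 0`. -/
theorem stmt_6 (m n p : ℕ) (A : Matrix (Fin m) (Fin n) ℝ) (B : Matrix (Fin p) (Fin n) ℝ)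
    (Q : Matrix (Fin n) (Fin n) ℝ)
    (hA : Function.Injective fun a : Fin m → ℝ => Aᵀ *ᵥ a)
    (hcompat : LinearMap.range (Bᵀ.mulVecLin) = LinearMap.ker (A.mulVecLin))
    (hQ : Q.PosDef)
    (u lam : Fin n → ℝ) (μ : Fin n → ℝ) (hμ : μ = lam + Q *ᵥ u) :
    (Aᵀ * (A * Q * Aᵀ)⁻¹ * A) *ᵥ μ = u ↔ (A *ᵥ lam = 0 ∧ B *ᵥ u = 0) := by
  have hdet := isUnit_det_mul_mul_transpose hA hQ
  subst hμ
  rw [← mulVec_mulVec, ← mulVec_mulVec, mulVec_add]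
  constructor
  · intro h
    constructor
    · have hAQ : A *ᵥ (Q *ᵥ u) = A *ᵥ lam + A *ᵥ (Q *ᵥ u) := by
        nth_rewrite 1 [← h]
        rw [mulVec_mulVec, mulVec_mulVec, mulVec_mulVec, mul_nonsing_inv _ hdet, one_mulVec]
      exact right_eq_add.mp hAQ
    · rw [← h, mulVec_mulVec, mul_transpose_eq_zero_of_range_le_ker hcompat.le, zero_mulVec]
  · rintro ⟨hlam, hu⟩
    obtain ⟨a, rfl⟩ := exists_transpose_mulVec_eq_of_mulVec_eq_zero hA hcompat hu
    have hS : A *ᵥ (Q *ᵥ (Aᵀ *ᵥ a)) = (A * Q * Aᵀ) *ᵥ a := by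
      simp only [mulVec_mulVec, Matrix.mul_assoc]
    rw [hlam, zero_add, hS, mulVec_mulVec a, nonsing_inv_mul _ hdet, one_mulVec]
end

section
/- Let K be a real square matrix in 2×2 block form with blocks K_ii (invertible), K_ib, K_bi, K_bb, and let S := K_bb − K_bi K_ii⁻¹ K_ib. Let G be any generalized inverse of K, i.e., any matrix with K G K = K, and set F := the (b,b) block of G (equivalently F = t G tᵀ with t = (0 I) the boundary trace). Then S F S = S, i.e., F is a generalized inverse of the Schur complement S. -/
open Matrix

/-- If `G` is a generalized inverse of the block matrix `K` (i.e. `K G K = K`) and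
`K_ii` is invertible, then the `(b,b)` block `F` of `G` is a generalized inverse of the
Schur complement `S = K_bb − K_bi K_ii⁻¹ K_ib`: `S F S = S`. -/
theorem stmt_12 (ni nb : ℕ)
    (Kii : Matrix (Fin ni) (Fin ni) ℝ) (Kib : Matrix (Fin ni) (Fin nb) ℝ)
    (Kbi : Matrix (Fin nb) (Fin ni) ℝ) (Kbb : Matrix (Fin nb) (Fin nb) ℝ)
    (hKii : IsUnit Kii)
    (G : Matrix (Fin ni ⊕ Fin nb) (Fin ni ⊕ Fin nb) ℝ)
    (hG : fromBlocks Kii Kib Kbi Kbb * G * fromBlocks Kii Kib Kbi Kbb =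
      fromBlocks Kii Kib Kbi Kbb) :
    (Kbb - Kbi * Kii⁻¹ * Kib) * G.toBlocks₂₂ * (Kbb - Kbi * Kii⁻¹ * Kib) =
      Kbb - Kbi * Kii⁻¹ * Kib := by
  have h_det : IsUnit Kii.det := (isUnit_iff_isUnit_det Kii).mp hKii
  set S := Kbb - Kbi * Kii⁻¹ * Kib with hS
  set K := fromBlocks Kii Kib Kbi Kbb with hK
  let R : Matrix (Fin ni ⊕ Fin nb) (Fin ni ⊕ Fin nb) ℝ := fromBlocks 0 0 (-(Kbi * Kii⁻¹)) 1
  let C : Matrix (Fin ni ⊕ Fin nb) (Fin ni ⊕ Fin nb) ℝ := fromBlocks 0 (-(Kii⁻¹ * Kib)) 0 1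
  have hRK : R * K = fromBlocks 0 0 0 S := by
    simp [R, hK, hS, fromBlocks_multiply, Matrix.mul_assoc, nonsing_inv_mul _ h_det,
      sub_eq_neg_add]
  have hKC : K * C = fromBlocks 0 0 0 S := by
    simp [C, hK, hS, fromBlocks_multiply, Matrix.mul_assoc,
      mul_nonsing_inv_cancel_left _ _ h_det, sub_eq_neg_add]
  have hRKC : R * K * C = fromBlocks 0 0 0 S := by
    simp [hRK, C, fromBlocks_multiply]
  have h : R * K * G * (K * C) = R * K * C := by
    simpa only [Matrix.mul_assoc] using congrArg (fun M => R * M * C) hG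
  rw [hRKC, hRK, hKC, ← fromBlocks_toBlocks G] at h
  simpa [fromBlocks_multiply] using congrArg toBlocks₂₂ h
end

section
/- Let r : ℝ^{n_i} × ℝ^{n_b} → ℝ^{n_i} × ℝ^{n_b} be a map that is Fréchet differentiable at a point (g(û_b), û_b), and let g : ℝ^{n_b} → ℝ^{n_i} be differentiable at û_b such that the internal component of r(g(u_b), u_b) vanishes for all u_b in a neighborhood of û_b. Write the (negative) Jacobian of r at (g(û_b), û_b) in block form as K_ii, K_ib, K_bi, K_bb (so that the derivative of −r is given by these blocks), and assume K_ii is invertible. Define the condensed reaction map s : ℝ^{n_b} → ℝ^{n_b} by s(u_b) := −(boundary component of r(g(u_b), u_b)). Then g has derivative −K_ii⁻¹ K_ib at û_b, and s is differentiable at û_b with derivative K_bb − K_bi K_ii⁻¹ K_ib, the Schur complement of the tangent stiffness matrix. -/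
open Matrix

/-- Tangent of the nonlinear primal Schur complement: if the internal equilibrium
`(r (g u_b, u_b))_i = 0` holds near `û_b`, the negative Jacobian of `r` has blocks
`K_ii, K_ib, K_bi, K_bb` with `K_ii` invertible, and `g` is differentiable at `û_b`,
then `g` has derivative `−K_ii⁻¹ K_ib` and the condensed reaction map
`s(u_b) = −(r (g u_b, u_b))_b` has derivative `K_bb − K_bi K_ii⁻¹ K_ib`. -/
theorem stmt_13 (ni nb : ℕ)
    (r : (Fin ni → ℝ) × (Fin nb → ℝ) → (Fin ni → ℝ) × (Fin nb → ℝ))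
    (g : (Fin nb → ℝ) → (Fin ni → ℝ)) (ub₀ : Fin nb → ℝ)
    (Kii : Matrix (Fin ni) (Fin ni) ℝ) (Kib : Matrix (Fin ni) (Fin nb) ℝ)
    (Kbi : Matrix (Fin nb) (Fin ni) ℝ) (Kbb : Matrix (Fin nb) (Fin nb) ℝ)
    (hKii : IsUnit Kii)
    (hr : ∃ L : ((Fin ni → ℝ) × (Fin nb → ℝ)) →L[ℝ] ((Fin ni → ℝ) × (Fin nb → ℝ)),
      HasFDerivAt r L (g ub₀, ub₀) ∧
        ∀ v : (Fin ni → ℝ) × (Fin nb → ℝ),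
          L v = (-(Kii *ᵥ v.1 + Kib *ᵥ v.2), -(Kbi *ᵥ v.1 + Kbb *ᵥ v.2)))
    (hg : DifferentiableAt ℝ g ub₀)
    (heq : ∀ᶠ ub in nhds ub₀, (r (g ub, ub)).1 = 0) :
    HasFDerivAt g (LinearMap.toContinuousLinearMap (-(Kii⁻¹ * Kib)).mulVecLin) ub₀ ∧
      HasFDerivAt (fun ub => -(r (g ub, ub)).2)
        (LinearMap.toContinuousLinearMap (Kbb - Kbi * Kii⁻¹ * Kib).mulVecLin) ub₀ := by
  obtain ⟨L, hL, hLv⟩ := hr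
  have hdet : IsUnit Kii.det := (Matrix.isUnit_iff_isUnit_det Kii).mp hKii
  have hcomp : ∀ G : (Fin nb → ℝ) →L[ℝ] (Fin ni → ℝ), HasFDerivAt g G ub₀ →
      HasFDerivAt (fun ub => r (g ub, ub))
        (L.comp (G.prod (ContinuousLinearMap.id ℝ (Fin nb → ℝ)))) ub₀ := fun G hG =>
    HasFDerivAt.comp (f := fun ub => (g ub, ub)) ub₀ hL (hG.prodMk (hasFDerivAt_id ub₀))
  have hg' : HasFDerivAt g
      (LinearMap.toContinuousLinearMap (-(Kii⁻¹ * Kib)).mulVecLin) ub₀ := by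
    have hzero := (hcomp _ hg.hasFDerivAt).fst.unique
      ((hasFDerivAt_const (0 : Fin ni → ℝ) ub₀).congr_of_eventuallyEq heq)
    convert hg.hasFDerivAt using 1
    refine ContinuousLinearMap.ext fun v => ?_
    have hv : Kii *ᵥ fderiv ℝ g ub₀ v + Kib *ᵥ v = 0 := by
      simpa [hLv, neg_eq_zero, -neg_add_rev] using DFunLike.congr_fun hzero v
    have hinv : fderiv ℝ g ub₀ v = Kii⁻¹ *ᵥ (Kii *ᵥ fderiv ℝ g ub₀ v) := by
      rw [Matrix.mulVec_mulVec, Matrix.nonsing_inv_mul _ hdet, Matrix.one_mulVec]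
    rw [hinv, eq_neg_of_add_eq_zero_left hv]
    simp [Matrix.mulVec_neg, Matrix.mulVec_mulVec]
  refine ⟨hg', ?_⟩
  refine (hcomp _ hg').snd.fun_neg.congr_fderiv (ContinuousLinearMap.ext fun v => ?_)
  simp [hLv, Matrix.mulVec_neg, Matrix.mulVec_mulVec, Matrix.mul_assoc, sub_eq_add_neg, add_comm]
end

section
/- Let A be a real m×q matrix of full row rank (a ↦ Aᵀa injective), B a real p×q matrix with Range(x ↦ Bᵀx) = Ker(x ↦ Ax), Q a real symmetric positive definite q×q matrix, r : ℝⁿ → ℝⁿ any map, and t a real q×n matrix (trace operator). Then for every u ∈ ℝⁿ the following are equivalent: (i) there exists μ ∈ ℝ^q such that r(u) − tᵀ Q t u + tᵀ μ = 0 and Aᵀ (A Q Aᵀ)⁻¹ A μ = t u; (ii) there exists λ ∈ ℝ^q such that r(u) + tᵀ λ = 0, A λ = 0, and B (t u) = 0. Moreover μ and λ in these two formulations are related by μ = λ + Q t u. -/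
open Matrix

namespace Matrix

variable {k l o : Type*} [Fintype l] [DecidableEq l] [Fintype o]

/-- If the range of `Bᵀ` is the kernel of `A`, then `B * Aᵀ = 0`. -/
theorem mul_transpose_eq_zero_of_range_eq_ker {A : Matrix k o ℝ} {B : Matrix l o ℝ}
    (h : LinearMap.range Bᵀ.mulVecLin = LinearMap.ker A.mulVecLin) : B * Aᵀ = 0 := by
  have hAB : A * Bᵀ = 0 := by
    refine ext_of_mulVec_single fun i => ?_
    have hi : Bᵀ *ᵥ Pi.single i 1 ∈ LinearMap.ker A.mulVecLin := h ▸ ⟨Pi.single i 1, rfl⟩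
    rw [zero_mulVec, ← mulVec_mulVec]
    exact hi
  simpa using congrArg transpose hAB

variable [Fintype k] [DecidableEq k]

/-- For `Q` positive definite, `A` of full row rank and `range Bᵀ = ker A`, the Robin interface
condition on `lam + Q w` splits into balance of `lam` and continuity of `w`. -/
theorem mulVec_add_mulVec_eq_iff {A : Matrix k o ℝ} {B : Matrix l o ℝ} {Q : Matrix o o ℝ}
    (hA : Function.Injective fun a : k → ℝ => Aᵀ *ᵥ a)
    (h : LinearMap.range Bᵀ.mulVecLin = LinearMap.ker A.mulVecLin) (hQ : Q.PosDef)
    (lam w : o → ℝ) :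
    (Aᵀ * (A * Q * Aᵀ)⁻¹ * A) *ᵥ (lam + Q *ᵥ w) = w ↔ A *ᵥ lam = 0 ∧ B *ᵥ w = 0 := by
  have hBA := mul_transpose_eq_zero_of_range_eq_ker h
  have hS : (A * Q * Aᵀ).PosDef := by
    have := hQ.conjTranspose_mul_mul_same (B := Aᵀ) hA
    simpa [conjTranspose_eq_transpose_of_trivial] using this
  have hinv : A * Q * Aᵀ * (A * Q * Aᵀ)⁻¹ = 1 :=
    mul_nonsing_inv _ ((isUnit_iff_isUnit_det _).1 hS.isUnit)
  have hBP : B * (Aᵀ * (A * Q * Aᵀ)⁻¹ * A) = 0 := by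
    rw [← Matrix.mul_assoc, ← Matrix.mul_assoc, hBA, Matrix.zero_mul, Matrix.zero_mul]
  have hAQP : A * Q * (Aᵀ * (A * Q * Aᵀ)⁻¹ * A) = A := by
    rw [← Matrix.mul_assoc, ← Matrix.mul_assoc, hinv, Matrix.one_mul]
  constructor
  · intro hw
    refine ⟨?_, ?_⟩
    · have hAQ := congrArg ((A * Q) *ᵥ ·) hw
      rwa [mulVec_mulVec, hAQP, mulVec_add, mulVec_mulVec, add_eq_right] at hAQ
    · rw [← hw, mulVec_mulVec, hBP, zero_mulVec]
  · rintro ⟨hlam, hw⟩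
    rw [mulVec_add, ← mulVec_mulVec lam, hlam, mulVec_zero, zero_add]
    set P := Aᵀ * (A * Q * Aᵀ)⁻¹ * A
    set z := w - P *ᵥ (Q *ᵥ w) with hz
    have hBz : B *ᵥ z = 0 := by
      rw [hz, mulVec_sub, hw, mulVec_mulVec, hBP, zero_mulVec, sub_zero]
    have hker : Q *ᵥ z ∈ LinearMap.ker A.mulVecLin := by
      rw [LinearMap.mem_ker, mulVecLin_apply, mulVec_mulVec, hz, mulVec_sub,
        mulVec_mulVec (Q *ᵥ w), hAQP, mulVec_mulVec, sub_self]
    rw [← h] at hker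
    obtain ⟨y, hy⟩ := hker
    have hzz : z ⬝ᵥ Q *ᵥ z = 0 := by
      rw [← hy, mulVecLin_apply, dotProduct_mulVec, vecMul_transpose, hBz, zero_dotProduct]
    have hz0 : z = 0 := by
      by_contra hne
      have hpos := hQ.dotProduct_mulVec_pos hne
      rw [star_trivial, hzz] at hpos
      exact hpos.false
    exact (sub_eq_zero.1 hz0).symm

end Matrix

/-- Equivalence of the mixed (Robin) substructured formulation and the primal–dual
substructured formulation, with the mixed unknown related to the reaction by
`μ = λ + Q t u`. -/
theorem stmt_18 (m p q n : ℕ)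
    (A : Matrix (Fin m) (Fin q) ℝ) (B : Matrix (Fin p) (Fin q) ℝ)
    (Q : Matrix (Fin q) (Fin q) ℝ)
    (hA : Function.Injective fun a : Fin m → ℝ => Aᵀ *ᵥ a)
    (hcompat : LinearMap.range (Bᵀ.mulVecLin) = LinearMap.ker (A.mulVecLin))
    (hQ : Q.PosDef)
    (r : (Fin n → ℝ) → (Fin n → ℝ)) (t : Matrix (Fin q) (Fin n) ℝ) :
    ∀ u : Fin n → ℝ,
      ((∃ μ : Fin q → ℝ,
          r u - tᵀ *ᵥ (Q *ᵥ (t *ᵥ u)) + tᵀ *ᵥ μ = 0 ∧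
            (Aᵀ * (A * Q * Aᵀ)⁻¹ * A) *ᵥ μ = t *ᵥ u) ↔
        (∃ lam : Fin q → ℝ,
          r u + tᵀ *ᵥ lam = 0 ∧ A *ᵥ lam = 0 ∧ B *ᵥ (t *ᵥ u) = 0)) ∧
      (∀ lam : Fin q → ℝ,
        (r u + tᵀ *ᵥ lam = 0 ∧ A *ᵥ lam = 0 ∧ B *ᵥ (t *ᵥ u) = 0) ↔
          (r u - tᵀ *ᵥ (Q *ᵥ (t *ᵥ u)) + tᵀ *ᵥ (lam + Q *ᵥ (t *ᵥ u)) = 0 ∧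
            (Aᵀ * (A * Q * Aᵀ)⁻¹ * A) *ᵥ (lam + Q *ᵥ (t *ᵥ u)) = t *ᵥ u)) := by
  intro u
  have hrobin (lam : Fin q → ℝ) :
      (r u + tᵀ *ᵥ lam = 0 ∧ A *ᵥ lam = 0 ∧ B *ᵥ (t *ᵥ u) = 0) ↔
        (r u - tᵀ *ᵥ (Q *ᵥ (t *ᵥ u)) + tᵀ *ᵥ (lam + Q *ᵥ (t *ᵥ u)) = 0 ∧
          (Aᵀ * (A * Q * Aᵀ)⁻¹ * A) *ᵥ (lam + Q *ᵥ (t *ᵥ u)) = t *ᵥ u) := by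
    rw [mulVec_add_mulVec_eq_iff hA hcompat hQ, mulVec_add tᵀ,
      add_comm (tᵀ *ᵥ lam), ← add_assoc, sub_add_cancel]
  refine ⟨⟨?_, fun ⟨lam, hlam⟩ => ⟨_, (hrobin lam).1 hlam⟩⟩, hrobin⟩
  rintro ⟨μ, hμ⟩
  exact ⟨μ - Q *ᵥ (t *ᵥ u), (hrobin _).2 (by simpa only [sub_add_cancel] using hμ)⟩
end

section
/- Let A be a real m×q matrix of full row rank (a ↦ Aᵀa injective), B a real p×q matrix with Range(x ↦ Bᵀx) = Ker(x ↦ Ax), Q a real symmetric positive definite q×q matrix, and S a real q×q matrix with S + Q invertible. Suppose μ ∈ ℝ^q is written as μ = Bᵀ γ + Q Aᵀ v for some γ ∈ ℝᵖ, v ∈ ℝᵐ, and satisfies the mixed tangent equation (Aᵀ (A Q Aᵀ)⁻¹ A − (S + Q)⁻¹) μ = b for some b ∈ ℝ^q. Then S Aᵀ v − Bᵀ γ = (S + Q) b, and consequently A S Aᵀ v = A (S + Q) b. -/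
open Matrix

/-- Swapping the linear solvers: if the mixed interface unknown `μ = Bᵀ γ + Q Aᵀ v`
satisfies the mixed tangent equation `(Aᵀ (A Q Aᵀ)⁻¹ A − (S + Q)⁻¹) μ = b`, then
`S Aᵀ v − Bᵀ γ = (S + Q) b` and consequently `A S Aᵀ v = A (S + Q) b`. -/
theorem stmt_19 (m p q : ℕ)
    (A : Matrix (Fin m) (Fin q) ℝ) (B : Matrix (Fin p) (Fin q) ℝ)
    (Q S : Matrix (Fin q) (Fin q) ℝ)
    (hA : Function.Injective fun a : Fin m → ℝ => Aᵀ *ᵥ a)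
    (hcompat : LinearMap.range (Bᵀ.mulVecLin) = LinearMap.ker (A.mulVecLin))
    (hQ : Q.PosDef) (hSQ : IsUnit (S + Q))
    (γ : Fin p → ℝ) (v : Fin m → ℝ) (b : Fin q → ℝ) (μ : Fin q → ℝ)
    (hμ : μ = Bᵀ *ᵥ γ + Q *ᵥ (Aᵀ *ᵥ v))
    (heq : (Aᵀ * (A * Q * Aᵀ)⁻¹ * A - (S + Q)⁻¹) *ᵥ μ = b) :
    S *ᵥ (Aᵀ *ᵥ v) - Bᵀ *ᵥ γ = (S + Q) *ᵥ b ∧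
      (A * S * Aᵀ) *ᵥ v = A *ᵥ ((S + Q) *ᵥ b) := by
  have hAB : A *ᵥ (Bᵀ *ᵥ γ) = 0 := by
    have h : Bᵀ *ᵥ γ ∈ LinearMap.ker A.mulVecLin := hcompat ▸ ⟨γ, rfl⟩
    simpa using h
  have hPD : (A * Q * Aᵀ).PosDef := by
    have hvec : Function.Injective A.vecMul := by
      intro x y hxy
      exact hA (by simpa [mulVec_transpose] using hxy)
    simpa [conjTranspose_eq_transpose_of_trivial] using hQ.mul_mul_conjTranspose_same hvec
  have hAμ : A *ᵥ μ = (A * Q * Aᵀ) *ᵥ v := by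
    simp [hμ, mulVec_add, hAB, mulVec_mulVec, Matrix.mul_assoc]
  have hcoarse : (Aᵀ * (A * Q * Aᵀ)⁻¹ * A) *ᵥ μ = Aᵀ *ᵥ v := by
    rw [← mulVec_mulVec, hAμ, mulVec_mulVec,
      nonsing_inv_mul_cancel_right _ _ ((isUnit_iff_isUnit_det _).mp hPD.isUnit)]
  have hmain : S *ᵥ (Aᵀ *ᵥ v) - Bᵀ *ᵥ γ = (S + Q) *ᵥ b := by
    rw [← heq, sub_mulVec, hcoarse, mulVec_sub, mulVec_mulVec (M := S + Q) (N := (S + Q)⁻¹),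
      mul_nonsing_inv _ ((isUnit_iff_isUnit_det _).mp hSQ), one_mulVec, hμ, add_mulVec]
    abel
  refine ⟨hmain, ?_⟩
  rw [← hmain, mulVec_sub, hAB, sub_zero, mulVec_mulVec, mulVec_mulVec, Matrix.mul_assoc]
end
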